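/- arXiv:2306.14449 — 2 statements merged into one kernel-verified Lean document; each statement's English description precedes it below -/
import Mathlib

section
/- Let (M,d) be a metric space satisfying the ρ-chain condition for a scale function ρ with β₁(ρ) ≥ 1, and let ψ_c be a scale function. Assume there exists a constant C ≥ 1 such that for all x, y ∈ M and all 0 < ε < d(x,y): (d_ε(x,y)/ε)² ≤ C ψ_c(d(x,y))/ψ_c(ε). Then there exists a constant C₅ > 0 such that for all 0 < r₁ ≤ r₂ < diam(M,d): ρ(r₂)/ρ(r₁) ≤ C₅ √(ψ_c(r₂)/ψ_c(r₁)). -/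
open scoped ENNReal

/-- A scale function with constant `C` and exponents `β₁ ≤ β₂`:
a positive, continuous, strictly increasing function on `(0,∞)` tending to `0`
at `0⁺` and to `∞` at `∞`, with two-sided power-type comparison. -/
structure IsScale (φ : ℝ → ℝ) (C β₁ β₂ : ℝ) : Prop where
  one_le_C : 1 ≤ C
  beta1_pos : 0 < β₁
  beta_le : β₁ ≤ β₂
  pos : ∀ r : ℝ, 0 < r → 0 < φ r
  cont : ContinuousOn φ (Set.Ioi 0)
  mono : StrictMonoOn φ (Set.Ioi 0)
  tendsto_zero : Filter.Tendsto φ (nhdsWithin 0 (Set.Ioi 0)) (nhds 0)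
  tendsto_top : Filter.Tendsto φ Filter.atTop Filter.atTop
  lower : ∀ s t : ℝ, 0 < s → s ≤ t → C⁻¹ * (t / s) ^ β₁ ≤ φ t / φ s
  upper : ∀ s t : ℝ, 0 < s → s ≤ t → φ t / φ s ≤ C * (t / s) ^ β₂
/-- `ξ 0 = x, …, ξ (N+1) = y` is an `ε`-chain from `x` to `y`. -/
def IsChainSeq {M : Type*} [MetricSpace M] (ε : ℝ) (x y : M) (N : ℕ) (ξ : ℕ → M) : Prop :=
  ξ 0 = x ∧ ξ (N + 1) = y ∧ ∀ i ≤ N, dist (ξ i) (ξ (i + 1)) < ε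

/-- The chain distance `d_ε(x,y)`: the infimum of total lengths of `ε`-chains from
`x` to `y`, equal to `∞` when no `ε`-chain exists. -/
noncomputable def chainDist {M : Type*} [MetricSpace M] (ε : ℝ) (x y : M) : ℝ≥0∞ :=
  ⨅ (N : ℕ) (ξ : ℕ → M) (_ : IsChainSeq ε x y N ξ),
    ENNReal.ofReal (∑ i ∈ Finset.range (N + 1), dist (ξ i) (ξ (i + 1)))

/-- The `ρ`-chain condition with constant `Cρ`:
`Cρ⁻¹ ρ(d(x,y))/ρ(ε) ≤ d_ε(x,y)/ε ≤ Cρ ρ(d(x,y))/ρ(ε)` for all `0 < ε < d(x,y)`. -/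
def RhoChainCond (M : Type*) [MetricSpace M] (ρ : ℝ → ℝ) (Cρ : ℝ) : Prop :=
  ∀ x y : M, ∀ ε : ℝ, 0 < ε → ε < dist x y →
    ENNReal.ofReal (Cρ⁻¹ * (ρ (dist x y) / ρ ε) * ε) ≤ chainDist ε x y ∧
    chainDist ε x y ≤ ENNReal.ofReal (Cρ * (ρ (dist x y) / ρ ε) * ε)

/-- Two points joined by an `r`-chain and more than `r` apart witness a distance in `[r, 2r)`. -/
theorem IsChainSeq.exists_dist_mem_Ico {M : Type*} [MetricSpace M] {r : ℝ} {x y : M} {N : ℕ}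
    {ξ : ℕ → M} (h : IsChainSeq r x y N ξ) (hr : 0 < r) (hxy : r < dist x y) :
    ∃ z : M, dist x z ∈ Set.Ico r (2 * r) := by
  classical
  obtain ⟨h0, h1, hstep⟩ := h
  have hex : ∃ n, r ≤ dist x (ξ n) := ⟨N + 1, by rw [h1]; exact hxy.le⟩
  have hle : Nat.find hex ≤ N + 1 := Nat.find_min' hex (by rw [h1]; exact hxy.le)
  have hspec := Nat.find_spec hex
  obtain hn | ⟨k, hk⟩ : Nat.find hex = 0 ∨ ∃ k, Nat.find hex = k + 1 := by
    cases Nat.find hex <;> simp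
  · rw [hn, h0, dist_self] at hspec
    exact absurd hspec hr.not_ge
  · refine ⟨ξ (Nat.find hex), hspec, ?_⟩
    have hlt : dist x (ξ k) < r := not_le.mp (Nat.find_min hex (by omega))
    have hs := hstep k (by omega)
    rw [hk]
    linarith [dist_triangle x (ξ k) (ξ (k + 1))]

theorem exists_isChainSeq_of_chainDist_ne_top {M : Type*} [MetricSpace M] {ε : ℝ} {x y : M}
    (h : chainDist ε x y ≠ ∞) : ∃ N ξ, IsChainSeq ε x y N ξ := by
  contrapose! h
  simp [chainDist, h]

theorem RhoChainCond.chainDist_ne_top {M : Type*} [MetricSpace M] {ρ : ℝ → ℝ} {Cρ ε : ℝ}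
    (h : RhoChainCond M ρ Cρ) {x y : M} (hε : 0 < ε) (hxy : ε < dist x y) :
    chainDist ε x y ≠ ∞ :=
  ne_top_of_le_ne_top ENNReal.ofReal_ne_top (h x y ε hε hxy).2

theorem RhoChainCond.div_le {M : Type*} [MetricSpace M] {ρ : ℝ → ℝ} {Cρ ε : ℝ}
    (h : RhoChainCond M ρ Cρ) (hC : 0 < Cρ) {x y : M} (hε : 0 < ε) (hxy : ε < dist x y) :
    ρ (dist x y) / ρ ε ≤ Cρ * ((chainDist ε x y).toReal / ε) := by
  have h1 := (ENNReal.ofReal_le_iff_le_toReal (h.chainDist_ne_top hε hxy)).mp (h x y ε hε hxy).1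
  rw [← le_div_iff₀ hε, inv_mul_le_iff₀ hC] at h1
  exact h1

theorem exists_lt_dist_of_ofReal_lt_ediam {M : Type*} [MetricSpace M] {r : ℝ}
    (h : ENNReal.ofReal r < Metric.ediam (Set.univ : Set M)) : ∃ x y : M, r < dist x y := by
  contrapose! h
  refine Metric.ediam_le fun x _ y _ => ?_
  rw [edist_dist]
  exact ENNReal.ofReal_le_ofReal (h x y)

/-- Under the `ρ`-chain condition, if
`(d_ε(x,y)/ε)² ≤ C ψ_c(d(x,y))/ψ_c(ε)` for all `0 < ε < d(x,y)`, then there is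
`C₅ > 0` with `ρ(r₂)/ρ(r₁) ≤ C₅ √(ψ_c(r₂)/ψ_c(r₁))` for all
`0 < r₁ ≤ r₂ < diam(M,d)`. -/
theorem rho_sqrt_psi_comparison {M : Type*} [MetricSpace M]
    (ρ ψc : ℝ → ℝ) (C₀ γ₁ γ₂ Cc βc₁ βc₂ Cρ C : ℝ)
    (hρ : IsScale ρ C₀ γ₁ γ₂) (hγ₁ : 1 ≤ γ₁)
    (hψc : IsScale ψc Cc βc₁ βc₂)
    (hCρ : 1 ≤ Cρ) (hchain : RhoChainCond M ρ Cρ)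
    (hC : 1 ≤ C)
    (hcomp : ∀ x y : M, ∀ ε : ℝ, 0 < ε → ε < dist x y →
      ((chainDist ε x y).toReal / ε) ^ 2 ≤ C * (ψc (dist x y) / ψc ε)) :
    ∃ C₅ : ℝ, 0 < C₅ ∧ ∀ r₁ r₂ : ℝ, 0 < r₁ → r₁ ≤ r₂ →
      ENNReal.ofReal r₂ < EMetric.diam (Set.univ : Set M) →
      ρ r₂ / ρ r₁ ≤ C₅ * Real.sqrt (ψc r₂ / ψc r₁) := by
  refine ⟨Cρ * √(C * (Cc * 2 ^ βc₂)) + 1, by positivity, fun r₁ r₂ h₁ h₁₂ hdiam => ?_⟩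
  have h₂ : 0 < r₂ := h₁.trans_le h₁₂
  obtain rfl | hlt := h₁₂.eq_or_lt
  · rw [div_self (hρ.pos _ h₁).ne', div_self (hψc.pos _ h₁).ne', Real.sqrt_one, mul_one]
    exact le_add_of_nonneg_left (by positivity)
  obtain ⟨x, y, hxy⟩ := exists_lt_dist_of_ofReal_lt_ediam hdiam
  obtain ⟨N, ξ, hξ⟩ := exists_isChainSeq_of_chainDist_ne_top (hchain.chainDist_ne_top h₂ hxy)
  obtain ⟨z, hz, hz'⟩ := hξ.exists_dist_mem_Ico h₂ hxy
  have hR : r₁ < dist x z := hlt.trans_le hz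
  have hρ₁ := hρ.pos _ h₁
  have hψ₁ := hψc.pos _ h₁
  have hψ₂ := hψc.pos _ h₂
  have hCc := hψc.one_le_C
  have hβ : 0 ≤ βc₂ := hψc.beta1_pos.le.trans hψc.beta_le
  have hψR : ψc (dist x z) ≤ Cc * 2 ^ βc₂ * ψc r₂ := by
    rw [← div_le_iff₀ hψ₂]
    refine (hψc.upper _ _ h₂ hz).trans ?_
    gcongr
    rw [div_le_iff₀ h₂]
    exact hz'.le
  have hρR : ρ r₂ ≤ ρ (dist x z) := hρ.mono.monotoneOn h₂ (h₂.trans_le hz) hz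
  calc ρ r₂ / ρ r₁ ≤ ρ (dist x z) / ρ r₁ := by gcongr
    _ ≤ Cρ * ((chainDist r₁ x z).toReal / r₁) := hchain.div_le (by positivity) h₁ hR
    _ ≤ Cρ * √(C * (ψc (dist x z) / ψc r₁)) := by
      gcongr
      exact Real.le_sqrt_of_sq_le (hcomp x z r₁ h₁ hR)
    _ ≤ Cρ * √(C * (Cc * 2 ^ βc₂ * ψc r₂ / ψc r₁)) := by gcongr
    _ = Cρ * √(C * (Cc * 2 ^ βc₂)) * √(ψc r₂ / ψc r₁) := by
      rw [mul_assoc Cρ, ← Real.sqrt_mul (by positivity)]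
      congr 2
      ring
    _ ≤ (Cρ * √(C * (Cc * 2 ^ βc₂)) + 1) * √(ψc r₂ / ψc r₁) := by
      gcongr
      exact le_add_of_nonneg_right zero_le_one
end

section
/- Let (M,d) be a metric space satisfying the ρ-chain condition for a scale function ρ with β₁(ρ) ≥ 1, and for ε > 0 let F_{ρ,ε}⁻¹ denote the inverse of the continuous increasing bijection F_{ρ,ε} of (0,∞). Then there exists a constant C ≥ 1 such that for all x ∈ M and all ε, r > 0: B_d(x, C⁻¹ F_{ρ,ε}(r)) ⊆ B_{d_ε}(x, r) ⊆ B_d(x, C F_{ρ,ε}(r)), and B_{d_ε}(x, C⁻¹ F_{ρ,ε}⁻¹(r)) ⊆ B_d(x, r) ⊆ B_{d_ε}(x, C F_{ρ,ε}⁻¹(r)), where B_d(x,r) = {y : d(x,y) < r} and B_{d_ε}(x,r) = {y : d_ε(x,y) < r}. -/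
open scoped ENNReal

/-- The metric transform `F_{ρ,ε}`: identity up to `ε`, then `ρ⁻¹((r/ε)·ρ(ε))`. -/
noncomputable def Frho (ρ ρinv : ℝ → ℝ) (ε r : ℝ) : ℝ :=
  if r ≤ ε then r else ρinv (r / ε * ρ ε)

/-- The inverse of the metric transform `Frho ρ ρinv ε`. -/
noncomputable def Grho (ρ : ℝ → ℝ) (ε s : ℝ) : ℝ :=
  if s ≤ ε then s else ε * (ρ s / ρ ε)

section Transform

variable {ρ ρinv : ℝ → ℝ} {C₀ γ₁ γ₂ ε : ℝ}

lemma lt_mul_div_of_isScale (hρ : IsScale ρ C₀ γ₁ γ₂) (hε : 0 < ε) {s : ℝ} (hs : ε < s) :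
    ε < ε * (ρ s / ρ ε) := by
  have h1 : ρ ε < ρ s := hρ.mono hε (hε.trans hs) hs
  have h2 : 1 < ρ s / ρ ε := (one_lt_div (hρ.pos ε hε)).2 h1
  nlinarith

lemma Grho_strictMonoOn (hρ : IsScale ρ C₀ γ₁ γ₂) (hε : 0 < ε) :
    StrictMonoOn (Grho ρ ε) (Set.Ici 0) := by
  intro s _ t _ hst
  unfold Grho
  split_ifs with h1 h2 h2
  · exact hst
  · exact h1.trans_lt (lt_mul_div_of_isScale hρ hε (not_le.1 h2))
  · exact absurd (hst.le.trans h2) h1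
  · have hs : 0 < s := hε.trans (not_le.1 h1)
    have := hρ.pos ε hε
    have := hρ.mono hs (hs.trans hst) hst
    gcongr

lemma Frho_pos (hρ : IsScale ρ C₀ γ₁ γ₂) (hinv : ∀ r : ℝ, 0 < r → 0 < ρinv r ∧ ρ (ρinv r) = r)
    (hε : 0 < ε) {r : ℝ} (hr : 0 < r) : 0 < Frho ρ ρinv ε r := by
  unfold Frho
  have := hρ.pos ε hε
  split_ifs
  · exact hr
  · exact (hinv _ (by positivity)).1

lemma Grho_Frho (hρ : IsScale ρ C₀ γ₁ γ₂) (hinv : ∀ r : ℝ, 0 < r → 0 < ρinv r ∧ ρ (ρinv r) = r)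
    (hε : 0 < ε) {r : ℝ} (hr : 0 < r) : Grho ρ ε (Frho ρ ρinv ε r) = r := by
  have hρε := hρ.pos ε hε
  unfold Frho
  split_ifs with h
  · simp [Grho, h]
  · obtain ⟨h1, h2⟩ := hinv (r / ε * ρ ε) (by positivity)
    have h3 : ¬ ρinv (r / ε * ρ ε) ≤ ε := by
      intro h4
      have h5 := hρ.mono.monotoneOn h1 hε h4
      rw [h2] at h5
      have h6 : 1 < r / ε := (one_lt_div hε).2 (not_le.1 h)
      nlinarith
    rw [Grho, if_neg h3, h2]
    field_simp

lemma Frho_Grho (hρ : IsScale ρ C₀ γ₁ γ₂) (hinv : ∀ r : ℝ, 0 < r → ρinv (ρ r) = r)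
    (hε : 0 < ε) {s : ℝ} (hs : 0 < s) : Frho ρ ρinv ε (Grho ρ ε s) = s := by
  have hρε := hρ.pos ε hε
  unfold Grho
  split_ifs with h
  · simp [Frho, h]
  · rw [Frho, if_neg (lt_mul_div_of_isScale hρ hε (not_le.1 h)).not_ge]
    have : ε * (ρ s / ρ ε) / ε * ρ ε = ρ s := by field_simp
    rw [this, hinv s hs]

lemma IsScale.div_le_mul_div (hρ : IsScale ρ C₀ γ₁ γ₂) (hγ₁ : 1 ≤ γ₁) {s t : ℝ} (hs : 0 < s)
    (hst : s ≤ t) : t / s ≤ C₀ * (ρ t / ρ s) := by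
  have hC := zero_lt_one.trans_le hρ.one_le_C
  have h1 : t / s ≤ (t / s) ^ γ₁ := Real.self_le_rpow_of_one_le ((one_le_div hs).2 hst) hγ₁
  have h2 := hρ.lower s t hs hst
  rw [inv_mul_le_iff₀ hC] at h2
  exact h1.trans h2

lemma mul_Grho_le (hρ : IsScale ρ C₀ γ₁ γ₂) (hγ₁ : 1 ≤ γ₁) (hε : 0 < ε) {c s : ℝ}
    (hc : 1 ≤ c) (hs : 0 ≤ s) : c * Grho ρ ε s ≤ C₀ * Grho ρ ε (c * s) := by
  have hC := hρ.one_le_C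
  have hρε := hρ.pos ε hε
  have hsc : s ≤ c * s := le_mul_of_one_le_left hs hc
  unfold Grho
  split_ifs with h1 h2 h2
  · exact le_mul_of_one_le_left (by positivity) hC
  · have h3 := hρ.div_le_mul_div hγ₁ hε (not_le.1 h2).le
    rw [div_le_iff₀ hε] at h3
    linarith
  · exact absurd (hsc.trans h2) h1
  · have hs' : 0 < s := hε.trans (not_le.1 h1)
    have hρs := hρ.pos s hs'
    have h3 := hρ.div_le_mul_div hγ₁ hs' hsc
    rw [mul_div_cancel_right₀ _ hs'.ne'] at h3
    calc c * (ε * (ρ s / ρ ε)) ≤ C₀ * (ρ (c * s) / ρ s) * (ε * (ρ s / ρ ε)) := by gcongr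
      _ = C₀ * (ε * (ρ (c * s) / ρ ε)) := by field_simp

end Transform

section ChainDist

variable {M : Type*} [MetricSpace M] {ε δ : ℝ} {x y : M}

lemma ofReal_dist_le_chainDist : ENNReal.ofReal (dist x y) ≤ chainDist ε x y := by
  refine le_iInf fun N => le_iInf fun ξ => le_iInf fun h => ENNReal.ofReal_le_ofReal ?_
  have := dist_le_range_sum_dist ξ (N + 1)
  rwa [h.1, h.2.1] at this

lemma chainDist_le_of_dist_lt (h : dist x y < ε) :
    chainDist ε x y ≤ ENNReal.ofReal (dist x y) := by
  refine (iInf_le_of_le 0 <| iInf_le_of_le (fun i => if i = 0 then x else y) <|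
    iInf_le_of_le ⟨by simp, by simp, ?_⟩ (by simp))
  intro i hi
  simpa [Nat.le_zero.1 hi] using h

lemma chainDist_anti (h : δ ≤ ε) : chainDist ε x y ≤ chainDist δ x y :=
  iInf_mono fun _ => iInf_mono fun _ => iInf_mono' fun hξ =>
    ⟨⟨hξ.1, hξ.2.1, fun i hi => (hξ.2.2 i hi).trans_le h⟩, le_rfl⟩

variable {ρ : ℝ → ℝ} {C₀ γ₁ γ₂ Cρ A : ℝ}

lemma ofReal_inv_mul_Grho_le_chainDist (hCρ : 1 ≤ Cρ) (hchain : RhoChainCond M ρ Cρ)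
    (hρ : IsScale ρ C₀ γ₁ γ₂) (hε : 0 < ε) (hA : Cρ ≤ A) :
    ENNReal.ofReal (A⁻¹ * Grho ρ ε (dist x y)) ≤ chainDist ε x y := by
  have hCρ0 := zero_lt_one.trans_le hCρ
  unfold Grho
  split_ifs with h
  · refine (ENNReal.ofReal_le_ofReal ?_).trans ofReal_dist_le_chainDist
    exact mul_le_of_le_one_left dist_nonneg (inv_le_one_of_one_le₀ (hCρ.trans hA))
  · rw [not_le] at h
    have := hρ.pos ε hε
    have := hρ.pos _ (hε.trans h)
    refine (ENNReal.ofReal_le_ofReal ?_).trans (hchain x y ε hε h).1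
    calc A⁻¹ * (ε * (ρ (dist x y) / ρ ε)) ≤ Cρ⁻¹ * (ε * (ρ (dist x y) / ρ ε)) := by gcongr
      _ = _ := by ring

lemma chainDist_le_ofReal_mul_Grho (hCρ : 1 ≤ Cρ) (hchain : RhoChainCond M ρ Cρ)
    (hρ : IsScale ρ C₀ γ₁ γ₂) (hε : 0 < ε) (hA : Cρ * (C₀ * 2 ^ γ₂) ≤ A) :
    chainDist ε x y ≤ ENNReal.ofReal (A * Grho ρ ε (dist x y)) := by
  have hCρ0 := zero_lt_one.trans_le hCρ
  have h2 : (1 : ℝ) ≤ C₀ * 2 ^ γ₂ := one_le_mul_of_one_le_of_one_le hρ.one_le_C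
    (Real.one_le_rpow one_le_two (hρ.beta1_pos.le.trans hρ.beta_le))
  have hA' : Cρ ≤ A := (le_mul_of_one_le_right hCρ0.le h2).trans hA
  unfold Grho
  split_ifs with h
  · rcases h.lt_or_eq with h | h
    · refine (chainDist_le_of_dist_lt h).trans (ENNReal.ofReal_le_ofReal ?_)
      exact le_mul_of_one_le_left dist_nonneg (hCρ.trans hA')
    · have hhalf : 0 < ε / 2 := half_pos hε
      refine (chainDist_anti (half_le_self hε.le)).trans
        ((hchain x y (ε / 2) hhalf (by linarith)).2.trans (ENNReal.ofReal_le_ofReal ?_))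
      have h3 := hρ.upper (ε / 2) ε hhalf (half_le_self hε.le)
      rw [div_div_cancel₀ hε.ne'] at h3
      rw [h]
      calc Cρ * (ρ ε / ρ (ε / 2)) * (ε / 2) ≤ Cρ * (C₀ * 2 ^ γ₂) * ε := by
            gcongr
            exact half_le_self hε.le
        _ ≤ A * ε := by gcongr
  · rw [not_le] at h
    have := hρ.pos ε hε
    have := hρ.pos _ (hε.trans h)
    refine (hchain x y ε hε h).2.trans (ENNReal.ofReal_le_ofReal ?_)
    calc Cρ * (ρ (dist x y) / ρ ε) * ε = Cρ * (ε * (ρ (dist x y) / ρ ε)) := by ring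
      _ ≤ A * (ε * (ρ (dist x y) / ρ ε)) := by gcongr

end ChainDist

/-- Under the `ρ`-chain condition there is `C ≥ 1` such that for
all `x`, `ε, r > 0`:
`B_d(x, C⁻¹F_{ρ,ε}(r)) ⊆ B_{d_ε}(x,r) ⊆ B_d(x, CF_{ρ,ε}(r))` and
`B_{d_ε}(x, C⁻¹F_{ρ,ε}⁻¹(r)) ⊆ B_d(x,r) ⊆ B_{d_ε}(x, CF_{ρ,ε}⁻¹(r))`. -/
theorem ball_comparison_chain_metric {M : Type*} [MetricSpace M]
    (ρ ρinv : ℝ → ℝ) (Finv : ℝ → ℝ → ℝ) (C₀ γ₁ γ₂ Cρ : ℝ)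
    (hρ : IsScale ρ C₀ γ₁ γ₂) (hγ₁ : 1 ≤ γ₁)
    (hinv₁ : ∀ r : ℝ, 0 < r → 0 < ρinv r ∧ ρ (ρinv r) = r)
    (hinv₂ : ∀ r : ℝ, 0 < r → ρinv (ρ r) = r)
    (hFinv₁ : ∀ ε r : ℝ, 0 < ε → 0 < r → 0 < Finv ε r ∧ Frho ρ ρinv ε (Finv ε r) = r)
    (hFinv₂ : ∀ ε r : ℝ, 0 < ε → 0 < r → Finv ε (Frho ρ ρinv ε r) = r)
    (hCρ : 1 ≤ Cρ) (hchain : RhoChainCond M ρ Cρ) :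
    ∃ C : ℝ, 1 ≤ C ∧ ∀ (x : M) (ε r : ℝ), 0 < ε → 0 < r →
      Metric.ball x (C⁻¹ * Frho ρ ρinv ε r) ⊆
        {y : M | chainDist ε x y < ENNReal.ofReal r} ∧
      {y : M | chainDist ε x y < ENNReal.ofReal r} ⊆
        Metric.ball x (C * Frho ρ ρinv ε r) ∧
      {y : M | chainDist ε x y < ENNReal.ofReal (C⁻¹ * Finv ε r)} ⊆
        Metric.ball x r ∧
      Metric.ball x r ⊆
        {y : M | chainDist ε x y < ENNReal.ofReal (C * Finv ε r)} := by
  obtain ⟨A, hAdef⟩ : ∃ A, A = Cρ * (C₀ * 2 ^ γ₂) := ⟨_, rfl⟩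
  have hC₀ := hρ.one_le_C
  have h2 : (1 : ℝ) ≤ C₀ * 2 ^ γ₂ := one_le_mul_of_one_le_of_one_le hC₀
    (Real.one_le_rpow one_le_two (hρ.beta1_pos.le.trans hρ.beta_le))
  have hCA : Cρ ≤ A := by rw [hAdef]; exact le_mul_of_one_le_right (by linarith) h2
  have hA1 : 1 ≤ A := hCρ.trans hCA
  have hA0 : 0 < A := by linarith
  have hC1 : 1 ≤ C₀ * A := one_le_mul_of_one_le_of_one_le hC₀ hA1
  have hC0 : 0 < C₀ * A := by linarith
  have hAC : A ≤ C₀ * A := le_mul_of_one_le_left hA0.le hC₀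
  refine ⟨C₀ * A, hC1, fun x ε r hε hr => ?_⟩
  have hF := Frho_pos hρ hinv₁ hε hr
  have hGF := Grho_Frho hρ hinv₁ hε hr
  have hmono := Grho_strictMonoOn hρ hε
  have hGr : 0 < Grho ρ ε r := by
    simpa [Grho, hε.le] using hmono (Set.mem_Ici.2 le_rfl) hr.le hr
  have hFinv : Finv ε r = Grho ρ ε r := by
    rw [← hFinv₂ ε _ hε hGr, Frho_Grho hρ hinv₂ hε hr]
  have lower (y : M) := ofReal_inv_mul_Grho_le_chainDist (x := x) (y := y) hCρ hchain hρ hε hCA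
  have upper (y : M) := chainDist_le_ofReal_mul_Grho (x := x) (y := y) hCρ hchain hρ hε hAdef.ge
  have lt_of_chainDist_lt {y : M} {t : ℝ} (ht : 0 < t)
      (h : chainDist ε x y < ENNReal.ofReal t) : Grho ρ ε (dist x y) < A * t := by
    have := (ENNReal.ofReal_lt_ofReal_iff ht).1 ((lower y).trans_lt h)
    rwa [inv_mul_lt_iff₀ hA0] at this
  refine ⟨fun y hy => ?_, fun y hy => ?_, fun y hy => ?_, fun y hy => ?_⟩
  · rw [Metric.mem_ball', lt_inv_mul_iff₀ hC0] at hy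
    refine (upper y).trans_lt ((ENNReal.ofReal_lt_ofReal_iff hr).2 ?_)
    have h3 := mul_Grho_le hρ hγ₁ hε hC1 (dist_nonneg (x := x) (y := y))
    have h4 := hmono (Set.mem_Ici.2 (by positivity)) hF.le hy
    rw [hGF] at h4
    rw [mul_assoc] at h3
    exact (le_of_mul_le_mul_left h3 (by linarith)).trans_lt h4
  · have h3 := lt_of_chainDist_lt hr hy
    rw [Metric.mem_ball']
    by_contra! h4
    have h5 := hmono.monotoneOn (Set.mem_Ici.2 (by positivity)) dist_nonneg h4
    have h6 := mul_Grho_le hρ hγ₁ hε hC1 hF.le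
    rw [hGF, mul_assoc] at h6
    exact absurd ((le_of_mul_le_mul_left h6 (by linarith)).trans h5) h3.not_ge
  · rw [hFinv] at hy
    have h3 := lt_of_chainDist_lt (by positivity) hy
    rw [Metric.mem_ball', ← hmono.lt_iff_lt dist_nonneg hr.le]
    refine h3.trans_le ?_
    rw [mul_left_comm, inv_mul_le_iff₀ hC0]
    gcongr
  · rw [Metric.mem_ball'] at hy
    refine (upper y).trans_lt ((ENNReal.ofReal_lt_ofReal_iff ?_).2 ?_)
    · rw [hFinv]; positivity
    · rw [hFinv]
      have h3 := hmono dist_nonneg hr.le hy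
      calc A * Grho ρ ε (dist x y) < A * Grho ρ ε r := by gcongr
        _ ≤ C₀ * A * Grho ρ ε r := by gcongr
end
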